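/- Let J(t) = (1/d!) · D^{n-d}[t^{n-d}(1+t)^d], with largest root λ = z_d and second largest root z_{d-1}. Then z_d - z_{d-1} ≥ n^{-(n-d)}. -/

import Mathlib

open Polynomial

/-- The derivative of a real-rooted real polynomial is real-rooted. -/
theorem Polynomial.Splits.derivative_real {p : ℝ[X]} (hp : p.Splits) :
    (derivative p).Splits := by
  have h1 := card_roots_le_derivative p
  have h2 := natDegree_derivative_le p
  have h3 := card_roots' (derivative p)
  have h4 := splits_iff_card_roots.1 hp
  exact splits_iff_card_roots.2 (by omega)

theorem Polynomial.Splits.iterate_derivative_real {p : ℝ[X]} (hp : p.Splits) (k : ℕ) :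
    (derivative^[k] p).Splits := by
  induction k with
  | zero => exact hp
  | succ k ih =>
    rw [Function.iterate_succ_apply']
    exact ih.derivative_real

/-- A nonzero solution of a second order linear differential equation has only simple roots
away from the zeros of the leading coefficient. -/
theorem Polynomial.eval_derivative_ne_zero_of_second_order_ode {p a b c : ℝ[X]} {x : ℝ}
    (hp : p ≠ 0) (hx : p.IsRoot x) (ha : a.eval x ≠ 0)
    (hode : a * derivative (derivative p) + b * derivative p = c * p) :
    (derivative p).eval x ≠ 0 := by
  intro hx'
  have hr : 1 < p.rootMultiplicity x := (one_lt_rootMultiplicity_iff_isRoot hp).2 ⟨hx, hx'⟩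
  have ne_zero_of_root : ∀ q : ℝ[X], q ≠ 0 → q.IsRoot x → derivative q ≠ 0 := by
    intro q hq hqx h
    rw [eq_C_of_derivative_eq_zero h] at hqx hq
    rw [IsRoot, eval_C] at hqx
    exact hq (by rw [hqx, C_0])
  have hp' := ne_zero_of_root p hp hx
  have hp'' := ne_zero_of_root _ hp' hx'
  have m1 := derivative_rootMultiplicity_of_root hx
  have m2 := derivative_rootMultiplicity_of_root (show (derivative p).IsRoot x from hx')
  set r := p.rootMultiplicity x
  have d0 : (X - C x) ^ (r - 1) ∣ p := (le_rootMultiplicity_iff hp).1 (Nat.sub_le _ _)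
  have d1 : (X - C x) ^ (r - 1) ∣ derivative p := (le_rootMultiplicity_iff hp').1 m1.ge
  have d2 : (X - C x) ^ (r - 1) ∣ a * derivative (derivative p) := by
    rw [eq_sub_of_add_eq hode]
    exact dvd_sub (d0.mul_left _) (d1.mul_left _)
  have hcop : IsCoprime ((X - C x) ^ (r - 1)) a := by
    refine IsCoprime.pow_left ((irreducible_X_sub_C x).coprime_iff_not_dvd.2 ?_)
    rwa [dvd_iff_isRoot]
  have := (le_rootMultiplicity_iff hp'').2 (hcop.dvd_of_dvd_mul_left d2)
  omega

/-- At a simple root `x` of a polynomial which splits, `p''(x) / (2 p'(x))` is the sum of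
`1 / (x - z)` over the other roots `z`. -/
theorem Polynomial.Splits.eval_derivative_derivative_of_simple_root {p : ℝ[X]} (hp : p.Splits)
    {x : ℝ} (hx : p.IsRoot x) (hx' : (derivative p).eval x ≠ 0) :
    (derivative (derivative p)).eval x =
      2 * (derivative p).eval x * ((p.roots.erase x).map fun z ↦ 1 / (x - z)).sum := by
  obtain ⟨q, rfl⟩ := dvd_iff_isRoot.2 hx
  have hne : (X - C x) * q ≠ 0 := by
    intro h
    rw [h] at hx'
    simp at hx'
  have hq : q.Splits := hp.of_dvd hne (dvd_mul_left _ _)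
  have hroots : ((X - C x) * q).roots.erase x = q.roots := by
    rw [roots_mul hne, roots_X_sub_C, Multiset.singleton_add, Multiset.erase_cons_head]
  have e1 : (derivative ((X - C x) * q)).eval x = q.eval x := by simp
  rw [e1] at hx'
  rw [hroots, ← hq.eval_derivative_div_eval_of_ne_zero hx', e1]
  have e2 : (derivative (derivative ((X - C x) * q))).eval x = 2 * (derivative q).eval x := by
    simp
    ring
  rw [e2]
  field_simp

/-- The unnormalized Jacobi polynomial `D^m [t^m (1 + t)^d]`. -/
noncomputable def jacobiRodrigues (m d : ℕ) : ℝ[X] :=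
  derivative^[m] ((X : ℝ[X]) ^ m * (1 + X) ^ d)

namespace jacobiRodrigues

variable (m d : ℕ)

theorem coeff_eq (k : ℕ) :
    (jacobiRodrigues m d).coeff k = ((k + m).descFactorial m : ℝ) * (d.choose k : ℝ) := by
  rw [jacobiRodrigues, coeff_iterate_derivative, coeff_X_pow_mul, coeff_one_add_X_pow,
    nsmul_eq_mul]

theorem coeff_nonneg (k : ℕ) : 0 ≤ (jacobiRodrigues m d).coeff k := by
  rw [coeff_eq]
  positivity

theorem coeff_zero_pos : 0 < (jacobiRodrigues m d).coeff 0 := by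
  rw [coeff_eq, zero_add, Nat.descFactorial_self, Nat.choose_zero_right]
  positivity

theorem ne_zero : jacobiRodrigues m d ≠ 0 := by
  intro h
  have := coeff_zero_pos m d
  simp [h] at this

theorem eval_pos {x : ℝ} (hx : 0 ≤ x) : 0 < (jacobiRodrigues m d).eval x := by
  rw [eval_eq_sum_range]
  refine Finset.sum_pos' (fun k _ ↦ mul_nonneg (coeff_nonneg m d k) (pow_nonneg hx k))
    ⟨0, by simp, ?_⟩
  simpa using coeff_zero_pos m d

theorem neg_of_mem_roots {x : ℝ} (hx : x ∈ (jacobiRodrigues m d).roots) : x < 0 := by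
  by_contra! h
  exact (eval_pos m d h).ne' (isRoot_of_mem_roots hx)

theorem splits : (jacobiRodrigues m d).Splits := by
  refine Splits.iterate_derivative_real (Splits.mul (Splits.pow Splits.X m) (Splits.pow ?_ d)) m
  rw [add_comm, ← C_1]
  exact Splits.X_add_C 1

theorem card_roots_le : (jacobiRodrigues m d).roots.card ≤ d := by
  refine (card_roots' _).trans ((natDegree_iterate_derivative _ _).trans ?_)
  have h : ((X : ℝ[X]) ^ m * (1 + X) ^ d).natDegree ≤ m + d := by compute_degree
  omega

theorem coeff_succ (k : ℕ) :
    ((k : ℝ) + 1) ^ 2 * (jacobiRodrigues m d).coeff (k + 1) =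
      ((d : ℝ) - k) * (k + m + 1) * (jacobiRodrigues m d).coeff k := by
  have h1 : (k + 1) * (k + 1 + m).descFactorial m = (k + m + 1) * (k + m).descFactorial m := by
    have e1 := Nat.factorial_mul_descFactorial (show m ≤ k + 1 + m by omega)
    have e2 := Nat.factorial_mul_descFactorial (show m ≤ k + m by omega)
    rw [Nat.add_sub_cancel] at e1 e2
    have e3 : (k + 1 + m).factorial = (k + m + 1) * (k + m).factorial := by
      rw [show k + 1 + m = (k + m) + 1 by omega, Nat.factorial_succ]
    refine Nat.eq_of_mul_eq_mul_left (Nat.factorial_pos k) ?_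
    rw [Nat.factorial_succ] at e1
    calc _ = (k + 1) * k.factorial * (k + 1 + m).descFactorial m := by ring
      _ = (k + m + 1) * (k.factorial * (k + m).descFactorial m) := by rw [e1, e2, e3]
      _ = _ := by ring
  have h2 : (d.choose (k + 1) : ℝ) * (k + 1) = d.choose k * ((d : ℝ) - k) := by
    rcases le_or_gt k d with h | h
    · have := Nat.choose_succ_right_eq d k
      rw [← Nat.cast_sub h]
      exact_mod_cast this
    · rw [Nat.choose_eq_zero_of_lt h, Nat.choose_eq_zero_of_lt (by omega)]
      simp
  have h1' : ((k : ℝ) + 1) * ((k + 1 + m).descFactorial m : ℝ) =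
      (k + m + 1) * ((k + m).descFactorial m : ℝ) := by exact_mod_cast h1
  rw [coeff_eq, coeff_eq]
  linear_combination ((d.choose (k + 1) : ℝ) * (k + 1)) * h1' +
    ((k : ℝ) + m + 1) * ((k + m).descFactorial m : ℝ) * h2

/-- The Jacobi differential equation. -/
theorem ode :
    (X * (1 + X)) * derivative (derivative (jacobiRodrigues m d)) +
      (1 + C ((m : ℝ) - d + 2) * X) * derivative (jacobiRodrigues m d) =
      C ((d : ℝ) * (m + 1)) * jacobiRodrigues m d := by
  ext k
  have e : (X * (1 + X)) * derivative (derivative (jacobiRodrigues m d)) +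
      (1 + C ((m : ℝ) - d + 2) * X) * derivative (jacobiRodrigues m d) =
      X * derivative (derivative (jacobiRodrigues m d)) +
      X * (X * derivative (derivative (jacobiRodrigues m d))) +
      derivative (jacobiRodrigues m d) +
      C ((m : ℝ) - d + 2) * (X * derivative (jacobiRodrigues m d)) := by ring
  have hk := coeff_succ m d k
  rw [e, coeff_C_mul, coeff_add, coeff_add, coeff_add, coeff_C_mul]
  rcases k with _ | _ | k <;> simp [coeff_derivative, coeff_X_mul] at hk ⊢ <;>
    linear_combination hk

/-- The reciprocals of the absolute values of the roots add up to `d (m + 1)`. -/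
theorem sum_neg_inv_roots :
    ((jacobiRodrigues m d).roots.map fun z ↦ 1 / (0 - z)).sum = (d : ℝ) * (m + 1) := by
  have h0 := (eval_pos m d le_rfl).ne'
  rw [← (splits m d).eval_derivative_div_eval_of_ne_zero h0, div_eq_iff h0]
  simpa using congrArg (eval 0) (ode m d)

theorem replicate_neg_one_le_roots :
    Multiset.replicate (d - m) (-1) ≤ (jacobiRodrigues m d).roots := by
  rw [← Multiset.le_count_iff_replicate_le, count_roots, le_rootMultiplicity_iff (ne_zero m d)]
  refine pow_sub_dvd_iterate_derivative_of_pow_dvd m (Dvd.dvd.mul_left ?_ _)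
  rw [C_neg, C_1, sub_neg_eq_add, add_comm]

variable {m d} {x y : ℝ}

theorem neg_inv_le_of_mem_roots (hx : x ∈ (jacobiRodrigues m d).roots) :
    1 / (0 - x) ≤ d * (m + 1) := by
  rw [← sum_neg_inv_roots]
  refine Multiset.single_le_sum ?_ _ (Multiset.mem_map_of_mem (fun z ↦ 1 / (0 - z)) hx)
  intro w hw
  obtain ⟨z, hz, rfl⟩ := Multiset.mem_map.1 hw
  have := neg_of_mem_roots m d hz
  exact one_div_nonneg.2 (by linarith)

theorem neg_one_lt_of_isGreatest_root (hm : 0 < m) (hx : x ∈ (jacobiRodrigues m d).roots)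
    (hmax : ∀ z ∈ (jacobiRodrigues m d).roots, z ≤ x) : -1 < x := by
  by_contra! h
  have hs := sum_neg_inv_roots m d
  have hle := Multiset.sum_le_card_nsmul
    ((jacobiRodrigues m d).roots.map fun z ↦ 1 / (0 - z)) 1 (by
      intro w hw
      obtain ⟨z, hz, rfl⟩ := Multiset.mem_map.1 hw
      have := hmax z hz
      rw [div_le_one (by linarith)]
      linarith)
  have hc := card_roots_le m d
  have hc0 : 0 < (jacobiRodrigues m d).roots.card := Multiset.card_pos_iff_exists_mem.2 ⟨x, hx⟩
  rw [hs, Multiset.card_map, nsmul_eq_mul, mul_one] at hle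
  have hle' : d * (m + 1) ≤ (jacobiRodrigues m d).roots.card := by exact_mod_cast hle
  nlinarith

/-- The largest root repels the other roots: `2 / (x - y) ≤ 1 / |x|`. -/
theorem gap_of_isGreatest_root (hm : 0 < m) (hx : x ∈ (jacobiRodrigues m d).roots)
    (hmax : ∀ z ∈ (jacobiRodrigues m d).roots, z ≤ x)
    (hy : y ∈ (jacobiRodrigues m d).roots.erase x) :
    0 < x - y ∧ 2 / (x - y) ≤ 1 / (0 - x) := by
  have hx0 := neg_of_mem_roots m d hx
  have hx1 := neg_one_lt_of_isGreatest_root hm hx hmax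
  have hroot := isRoot_of_mem_roots hx
  have hx' : (derivative (jacobiRodrigues m d)).eval x ≠ 0 := by
    refine eval_derivative_ne_zero_of_second_order_ode (ne_zero m d) hroot ?_ (ode m d)
    simp only [eval_mul, eval_add, eval_X, eval_one]
    exact mul_ne_zero hx0.ne (by linarith)
  have hcount : (jacobiRodrigues m d).roots.count x ≤ 1 := by
    rw [count_roots]
    by_contra! h
    exact hx' ((one_lt_rootMultiplicity_iff_isRoot (ne_zero m d)).1 h).2
  have hlt : ∀ z ∈ (jacobiRodrigues m d).roots.erase x, z < x := by
    intro z hz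
    refine lt_of_le_of_ne (hmax z (Multiset.mem_of_mem_erase hz)) ?_
    rintro rfl
    have := Multiset.count_pos.2 hz
    rw [Multiset.count_erase_self] at this
    omega
  have hode := congrArg (eval x) (ode m d)
  have hd2 := (splits m d).eval_derivative_derivative_of_simple_root hroot hx'
  simp only [eval_mul, eval_add, eval_X, eval_one, eval_C, hroot.eq_zero, hd2] at hode
  set S := (((jacobiRodrigues m d).roots.erase x).map fun z ↦ 1 / (x - z)).sum with hS
  have hx1' : 0 < 1 + x := by linarith
  have hsum : 2 * S = 1 / (0 - x) + ((d : ℝ) - m - 1) / (1 + x) := by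
    have : x * (1 + x) * (2 * S) + (1 + ((m : ℝ) - d + 2) * x) = 0 := by
      refine (mul_eq_zero.1 (?_ : (derivative (jacobiRodrigues m d)).eval x * _ = 0)).resolve_left
        hx'
      linear_combination hode
    have hx0' : x ≠ 0 := hx0.ne
    rw [zero_sub, div_add_div _ _ (neg_ne_zero.2 hx0') hx1'.ne', eq_div_iff (by
      exact mul_ne_zero (neg_ne_zero.2 hx0') hx1'.ne')]
    linear_combination -this
  have sum_le : ∀ s ≤ (jacobiRodrigues m d).roots.erase x,
      (s.map fun z ↦ 1 / (x - z)).sum ≤ S := by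
    intro s hs
    obtain ⟨t, ht⟩ := Multiset.le_iff_exists_add.1 hs
    rw [hS, ht, Multiset.map_add, Multiset.sum_add, le_add_iff_nonneg_right]
    refine Multiset.sum_nonneg fun w hw ↦ ?_
    obtain ⟨z, hz, rfl⟩ := Multiset.mem_map.1 hw
    have := hlt z (by rw [ht]; exact Multiset.mem_add.2 (Or.inr hz))
    exact one_div_nonneg.2 (by linarith)
  have hrep : Multiset.replicate (d - m) (-1) ≤ (jacobiRodrigues m d).roots.erase x := by
    rw [← Multiset.le_count_iff_replicate_le, Multiset.count_erase_of_ne (by linarith),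
      Multiset.le_count_iff_replicate_le]
    exact replicate_neg_one_le_roots m d
  have hyx := hlt y hy
  refine ⟨sub_pos.2 hyx, ?_⟩
  have hdm : (d : ℝ) - m ≤ (d - m : ℕ) := by
    rw [sub_le_iff_le_add]
    exact_mod_cast (show d ≤ d - m + m by omega)
  have hv : 0 < 1 / (1 + x) := one_div_pos.2 hx1'
  rw [div_eq_mul_one_div ((d : ℝ) - m - 1)] at hsum
  rw [div_eq_mul_one_div 2 (x - y)]
  by_cases hy1 : y = -1
  · subst hy1
    rw [sub_neg_eq_add, add_comm x 1]
    rcases Nat.eq_zero_or_pos (d - m) with hk | hk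
    · have hS1 := sum_le {-1} (Multiset.singleton_le.2 hy)
      rw [Multiset.map_singleton, Multiset.sum_singleton, sub_neg_eq_add, add_comm x 1] at hS1
      rw [hk, Nat.cast_zero] at hdm
      nlinarith
    · have hS1 := sum_le _ hrep
      rw [Multiset.map_replicate, Multiset.sum_replicate, nsmul_eq_mul, sub_neg_eq_add,
        add_comm x 1] at hS1
      have hk' : (1 : ℝ) ≤ (d - m : ℕ) := by exact_mod_cast hk
      nlinarith
  · have hS1 := sum_le (y ::ₘ Multiset.replicate (d - m) (-1))
      ((Multiset.cons_le_of_notMem fun h ↦ hy1 (Multiset.eq_of_mem_replicate h)).2 ⟨hy, hrep⟩)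
    rw [Multiset.map_cons, Multiset.sum_cons, Multiset.map_replicate, Multiset.sum_replicate,
      nsmul_eq_mul, sub_neg_eq_add, add_comm x 1] at hS1
    have hk0 : (0 : ℝ) ≤ (d - m : ℕ) := Nat.cast_nonneg _
    nlinarith

end jacobiRodrigues

/-- **Gap between the two largest roots of the Jacobi polynomial.** Let
`J(t) = (1/d!) · D^{n-d}[t^{n-d}(1+t)^d]`, let `zd` be its largest root (with
multiplicity, i.e. as an element of the root multiset) and `zd1` the largest among the
remaining roots. Then `zd - zd1 ≥ n^{-(n-d)}`. -/
theorem jacobi_root_gap (n d : ℕ) (hd : 2 ≤ d) (hnd : d < n)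
    (J : Polynomial ℝ)
    (hJ : J = (1 / (d.factorial : ℝ)) •
      (Polynomial.derivative^[n - d] ((X : Polynomial ℝ) ^ (n - d) * (1 + X) ^ d)))
    (zd zd1 : ℝ)
    (hzd : zd ∈ J.roots) (hzdmax : ∀ x ∈ J.roots, x ≤ zd)
    (hzd1 : zd1 ∈ J.roots.erase zd) (hzd1max : ∀ x ∈ J.roots.erase zd, x ≤ zd1) :
    zd - zd1 ≥ 1 / (n : ℝ) ^ (n - d) := by
  obtain ⟨m, rfl⟩ := Nat.exists_eq_add_of_lt hnd
  rw [show d + m + 1 - d = m + 1 by omega] at hJ ⊢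
  have hroots : J.roots = (jacobiRodrigues (m + 1) d).roots := by
    rw [hJ, roots_smul_nonzero _ (by positivity), jacobiRodrigues]
  rw [hroots] at hzd hzdmax hzd1
  obtain ⟨hpos, hgap⟩ :=
    jacobiRodrigues.gap_of_isGreatest_root m.succ_pos hzd hzdmax hzd1
  have hle := hgap.trans (jacobiRodrigues.neg_inv_le_of_mem_roots hzd)
  have hpow : d * (m + 1 + 1) ≤ 2 * (d + m + 1) ^ (m + 1) := by
    rcases m with _ | m
    · simp
      omega
    · calc d * (m + 1 + 1 + 1) ≤ 2 * (d + (m + 1) + 1) ^ 2 := by nlinarith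
        _ ≤ 2 * (d + (m + 1) + 1) ^ (m + 1 + 1) := by gcongr <;> omega
  have hpow' : (d : ℝ) * ((m + 1 : ℕ) + 1) ≤ 2 * ((d + m + 1 : ℕ) : ℝ) ^ (m + 1) := by
    exact_mod_cast hpow
  rw [div_le_iff₀ hpos] at hle
  rw [ge_iff_le, div_le_iff₀ (by positivity)]
  nlinarith
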